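/- Let (Q,P) be a weakly quasi-lattice ordered group and let Λ be a P-graph with FA(Λ) ≠ ∅. For any m ∈ P, both the domain D_m and the range R_m of the shift T_m are open subsets of PS(Λ). -/

import Mathlib

set_option autoImplicit false

/-- The topology on the power set `Set α` obtained by identifying it with the
product `∏ _ : α, Prop` where each (two-point) factor `Prop` carries the
discrete topology. -/
instance powersetTopology (α : Type) : TopologicalSpace (Set α) :=
  @Pi.topologicalSpace α (fun _ => Prop) (fun _ => ⊥)

/-- The cylinder `Z(K₁;K₂) = {x : K₁ ⊆ x ⊆ K₂ᶜ}`. -/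
def cylinder {α : Type} (K₁ K₂ : Set α) : Set (Set α) :=
  {x | K₁ ⊆ x ∧ x ⊆ K₂ᶜ}

/-- The relation `p ≤ r` iff `p * q = r` for some `q ∈ P`. -/
def Submonoid.leftLE {Q : Type} [Group Q] (P : Submonoid Q) (p r : Q) : Prop :=
  ∃ q ∈ P, p * q = r

/-- A weakly quasi-lattice ordered group `(Q,P)`: a group `Q` together with a
subsemigroup `P` containing the unit with `P ∩ P⁻¹ = {e}`, such that any two
elements of `P` with a common upper bound (for `leftLE`) have a least common
upper bound. -/
structure WQLO (Q : Type) [Group Q] where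
  P : Submonoid Q
  inter_inv : ∀ p ∈ P, p⁻¹ ∈ P → p = 1
  lub : ∀ a ∈ P, ∀ b ∈ P, (∃ c ∈ P, P.leftLE a c ∧ P.leftLE b c) →
    ∃ l ∈ P, P.leftLE a l ∧ P.leftLE b l ∧
      ∀ c ∈ P, P.leftLE a c → P.leftLE b c → P.leftLE l c

/-- A (discrete) `P`-graph: a countable small category, presented by its set of
morphisms `Λ` with range map `r`, source map `s` and a composition `mul`
(constrained by the axioms only on composable pairs, i.e. when `s μ = r ν`),
together with a degree functor `d : Λ → P` satisfying the unique factorisation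
property. The units of `Λ` are exactly the elements of the form `r lam`. -/
structure PGraph (Q : Type) [Group Q] (W : WQLO Q) where
  Λ : Type
  countable : Countable Λ
  r : Λ → Λ
  s : Λ → Λ
  mul : Λ → Λ → Λ
  d : Λ → Q
  d_mem : ∀ lam, d lam ∈ W.P
  s_r : ∀ lam, s (r lam) = r lam
  r_r : ∀ lam, r (r lam) = r lam
  s_s : ∀ lam, s (s lam) = s lam
  r_s : ∀ lam, r (s lam) = s lam
  id_mul : ∀ lam, mul (r lam) lam = lam
  mul_id : ∀ lam, mul lam (s lam) = lam
  r_mul : ∀ mu nu, s mu = r nu → r (mul mu nu) = r mu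
  s_mul : ∀ mu nu, s mu = r nu → s (mul mu nu) = s nu
  mul_assoc : ∀ mu nu k, s mu = r nu → s nu = r k →
    mul (mul mu nu) k = mul mu (mul nu k)
  d_unit : ∀ lam, d (r lam) = 1
  d_mul : ∀ mu nu, s mu = r nu → d (mul mu nu) = d mu * d nu
  factor : ∀ lam, ∀ p ∈ W.P, ∀ q ∈ W.P, d lam = p * q →
    ∃! mn : Λ × Λ, s mn.1 = r mn.2 ∧ mul mn.1 mn.2 = lam ∧ d mn.1 = p ∧ d mn.2 = q

namespace PGraph

variable {Q : Type} [Group Q] {W : WQLO Q} (G : PGraph Q W)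

/-- `λΛ = {λμ : μ ∈ Λ, s λ = r μ}`. -/
def cone (lam : G.Λ) : Set G.Λ :=
  {x | ∃ mu, G.s lam = G.r mu ∧ x = G.mul lam mu}

/-- `λE = {λμ : μ ∈ E, s λ = r μ}`. -/
def coneSet (lam : G.Λ) (E : Set G.Λ) : Set G.Λ :=
  {x | ∃ mu ∈ E, G.s lam = G.r mu ∧ x = G.mul lam mu}

/-- `Λ` is finitely aligned at the pair `(μ,ν)`. -/
def FinAlignedAtPair (mu nu : G.Λ) : Prop :=
  ∃ J : Finset G.Λ, G.cone mu ∩ G.cone nu = ⋃ lam ∈ (J : Set G.Λ), G.cone lam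

/-- `Λ` is finitely aligned at `λ`. -/
def FinAlignedAt (lam : G.Λ) : Prop :=
  ∀ mu ∈ G.cone lam, ∀ nu : G.Λ, G.FinAlignedAtPair mu nu

/-- The finitely aligned part `FA(Λ)`. -/
def FA : Set G.Λ := {lam | G.FinAlignedAt lam}

/-- `FAr(Λ) = FA(Λ) ∪ r(FA(Λ))`. -/
def FAr : Set G.Λ := G.FA ∪ G.r '' G.FA

/-- `μ ≼ λ` iff `μν = λ` for some `ν`. -/
def pre (mu lam : G.Λ) : Prop :=
  ∃ nu, G.s mu = G.r nu ∧ G.mul mu nu = lam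

/-- A filter: a nonempty, hereditary and directed subset of `Λ`. -/
def IsFilter (x : Set G.Λ) : Prop :=
  x.Nonempty ∧ (∀ lam mu, G.pre lam mu → mu ∈ x → lam ∈ x) ∧
    ∀ mu ∈ x, ∀ nu ∈ x, ∃ lam ∈ x, G.pre mu lam ∧ G.pre nu lam

/-- The space `ℱΛ` of filters, with the subspace topology from `𝒫(Λ)`. -/
abbrev FilterSpace := {x : Set G.Λ // G.IsFilter x}

/-- `Z_{ℱΛ}(μ;K) = {x ∈ ℱΛ : μ ∈ x ⊆ Λ∖K}`. -/
def Zf (mu : G.Λ) (K : Set G.Λ) : Set G.FilterSpace :=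
  {x | mu ∈ x.1 ∧ x.1 ⊆ Kᶜ}

/-- An ultrafilter: a filter maximal with respect to inclusion. -/
def IsUltrafilter (x : Set G.Λ) : Prop :=
  G.IsFilter x ∧ ∀ y, G.IsFilter y → x ⊆ y → x = y

/-- The path space `PS(Λ)`: filters meeting `FA(Λ)` (as a set of subsets). -/
def PS : Set (Set G.Λ) := {x | G.IsFilter x ∧ (x ∩ G.FA).Nonempty}

/-- The path space as a topological space (subspace of `𝒫(Λ)`). -/
abbrev PSpace := {x : Set G.Λ // x ∈ G.PS}

/-- The boundary-path space: the closure in `PS(Λ)` of the set of ultrafilters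
lying in `PS(Λ)`. -/
def BPS : Set G.PSpace := closure {x : G.PSpace | G.IsUltrafilter x.1}

abbrev BPSpace := {x : G.PSpace // x ∈ G.BPS}

/-- The left shift `λ⁻¹·x = {μ : λμ ∈ x}`. -/
def lshift (lam : G.Λ) (x : Set G.Λ) : Set G.Λ :=
  {mu | G.s lam = G.r mu ∧ G.mul lam mu ∈ x}

/-- The right shift `λ·x = {ζ : ζ ≼ λμ for some μ ∈ x}`. -/
def rshift (lam : G.Λ) (x : Set G.Λ) : Set G.Λ :=
  {z | ∃ mu ∈ x, G.s lam = G.r mu ∧ G.pre z (G.mul lam mu)}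

/-- The action `x·m`: the left shift of `x` by the unique element of
`x ∩ Λ^m` (when it exists). -/
def act (x : Set G.Λ) (m : Q) : Set G.Λ :=
  ⋃ lam ∈ {l ∈ x | G.d l = m}, G.lshift lam x

/-- The domain `D_m = {x ∈ PS(Λ) : x ∩ Λ^m ≠ ∅}` of `T_m`. -/
def Dom (m : Q) : Set (Set G.Λ) := {x ∈ G.PS | ∃ l ∈ x, G.d l = m}

/-- The range `R_m = {x·m : x ∈ D_m}` of `T_m`. -/
def Ran (m : Q) : Set (Set G.Λ) := {y | ∃ x ∈ G.Dom m, G.act x m = y}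

end PGraph

namespace PGraph

variable {Q : Type} [Group Q] {W : WQLO Q} (G : PGraph Q W)

theorem pre_trans {a b c : G.Λ} (hab : G.pre a b) (hbc : G.pre b c) : G.pre a c := by
  obtain ⟨u, hu, rfl⟩ := hab
  obtain ⟨v, hv, rfl⟩ := hbc
  rw [G.s_mul a u hu] at hv
  exact ⟨G.mul u v, by rw [G.r_mul u v hv, hu], (G.mul_assoc a u v hu hv).symm⟩

theorem pre_refl (a : G.Λ) : G.pre a a :=
  ⟨G.s a, (G.r_s a).symm, G.mul_id a⟩

theorem r_eq_of_pre {a b : G.Λ} (hab : G.pre a b) : G.r a = G.r b := by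
  obtain ⟨u, hu, rfl⟩ := hab
  exact (G.r_mul a u hu).symm

theorem pre_mul_left {lam a b : G.Λ} (ha : G.s lam = G.r a) (hab : G.pre a b) :
    G.pre (G.mul lam a) (G.mul lam b) := by
  obtain ⟨u, hu, rfl⟩ := hab
  exact ⟨u, by rw [G.s_mul lam a ha, hu], G.mul_assoc lam a u ha hu⟩

theorem factor_unique {a b a' b' : G.Λ} (h : G.s a = G.r b) (h' : G.s a' = G.r b')
    (hd : G.d a = G.d a') (he : G.mul a b = G.mul a' b') : a = a' ∧ b = b' := by
  have hdb : G.d b = G.d b' := by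
    have := congrArg G.d he
    rw [G.d_mul a b h, G.d_mul a' b' h', hd] at this
    exact mul_left_cancel this
  have hu := (G.factor (G.mul a b) (G.d a) (G.d_mem a) (G.d b) (G.d_mem b)
    (G.d_mul a b h)).unique (y₁ := (a, b)) (y₂ := (a', b'))
    ⟨h, rfl, rfl, rfl⟩ ⟨h', he.symm, hd.symm, hdb.symm⟩
  exact Prod.mk.inj hu

theorem mem_FA_of_pre {a b : G.Λ} (ha : a ∈ G.FA) (hab : G.pre a b) : b ∈ G.FA := by
  rintro mu ⟨u, hu, rfl⟩ nu
  obtain ⟨v, hv, hv'⟩ := G.pre_trans hab ⟨u, hu, rfl⟩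
  exact ha _ ⟨v, hv, hv'.symm⟩ nu

variable {G}

theorem IsFilter.r_eq {x : Set G.Λ} (hx : G.IsFilter x) {a b : G.Λ} (ha : a ∈ x) (hb : b ∈ x) :
    G.r a = G.r b := by
  obtain ⟨c, -, hac, hbc⟩ := hx.2.2 a ha b hb
  rw [G.r_eq_of_pre hac, G.r_eq_of_pre hbc]

theorem IsFilter.eq_of_d_eq {x : Set G.Λ} (hx : G.IsFilter x) {a b : G.Λ} (ha : a ∈ x)
    (hb : b ∈ x) (hd : G.d a = G.d b) : a = b := by
  obtain ⟨c, -, ⟨u, hu, rfl⟩, v, hv, he⟩ := hx.2.2 a ha b hb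
  exact (G.factor_unique hu hv hd he.symm).1

theorem IsFilter.act_eq {x : Set G.Λ} (hx : G.IsFilter x) {lam : G.Λ} (h : lam ∈ x) :
    G.act x (G.d lam) = G.lshift lam x := by
  ext mu
  simp only [act, Set.mem_iUnion, Set.mem_ofPred_eq, exists_prop]
  constructor
  · rintro ⟨l, ⟨hl, hd⟩, hmu⟩
    rwa [hx.eq_of_d_eq hl h hd] at hmu
  · exact fun hmu => ⟨lam, ⟨h, rfl⟩, hmu⟩

theorem IsFilter.rshift {y : Set G.Λ} (hy : G.IsFilter y) {lam nu : G.Λ} (hnu : nu ∈ y)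
    (h : G.s lam = G.r nu) : G.IsFilter (G.rshift lam y) := by
  refine ⟨⟨_, nu, hnu, h, G.pre_refl _⟩, ?_, ?_⟩
  · rintro a b hab ⟨mu, hmu, hs, hb⟩
    exact ⟨mu, hmu, hs, G.pre_trans hab hb⟩
  · rintro a ⟨mu, hmu, hs, ha⟩ b ⟨mu', hmu', hs', hb⟩
    obtain ⟨k, hk, h1, h2⟩ := hy.2.2 mu hmu mu' hmu'
    exact ⟨G.mul lam k, ⟨k, hk, hs.trans (G.r_eq_of_pre h1), G.pre_refl _⟩,
      G.pre_trans ha (G.pre_mul_left hs h1), G.pre_trans hb (G.pre_mul_left hs' h2)⟩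

theorem IsFilter.lshift_rshift {y : Set G.Λ} (hy : G.IsFilter y) {lam nu : G.Λ} (hnu : nu ∈ y)
    (h : G.s lam = G.r nu) : G.lshift lam (G.rshift lam y) = y := by
  ext mu
  constructor
  · rintro ⟨hs, k, hk, hk', u, hu, he⟩
    rw [G.s_mul lam mu hs] at hu
    rw [G.mul_assoc lam mu u hs hu] at he
    have := (G.factor_unique (by rw [G.r_mul mu u hu, hs]) hk' rfl he).2
    exact hy.2.1 mu k ⟨u, hu, this⟩ hk
  · intro hmu
    have hs : G.s lam = G.r mu := h.trans (hy.r_eq hnu hmu)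
    exact ⟨hs, mu, hmu, hs, G.pre_refl _⟩

/-- A path lies in the range of the `m`-shift iff it contains some `ν` that some `λ` of
degree `m` extends on the left into the finitely aligned part. -/
theorem mem_Ran_iff {y : Set G.Λ} (hy : G.IsFilter y) (m : Q) :
    y ∈ G.Ran m ↔ ∃ nu ∈ y, ∃ lam, G.d lam = m ∧ G.s lam = G.r nu ∧ G.mul lam nu ∈ G.FA := by
  constructor
  · rintro ⟨x, ⟨⟨hx, a, hax, ha⟩, lam, hlam, rfl⟩, rfl⟩
    obtain ⟨c, hc, ⟨nu, hnu, rfl⟩, hac⟩ := hx.2.2 lam hlam a hax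
    rw [hx.act_eq hlam]
    exact ⟨nu, ⟨hnu, hc⟩, lam, rfl, hnu, G.mem_FA_of_pre ha hac⟩
  · rintro ⟨nu, hnu, lam, rfl, hs, hFA⟩
    have hx := hy.rshift hnu hs
    have hlam : lam ∈ G.rshift lam y := ⟨nu, hnu, hs, nu, hs, rfl⟩
    refine ⟨G.rshift lam y, ⟨⟨hx, _, ⟨nu, hnu, hs, G.pre_refl _⟩, hFA⟩, lam, hlam, rfl⟩, ?_⟩
    rw [hx.act_eq hlam, hy.lshift_rshift hnu hs]

variable (G)

theorem isOpen_setOf_mem (lam : G.Λ) : IsOpen {x : G.PSpace | lam ∈ x.1} := by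
  have hc : @Continuous (Set G.Λ) Prop (powersetTopology G.Λ) ⊥ fun x => lam ∈ x :=
    @continuous_apply G.Λ (fun _ => Prop) (fun _ => ⊥) lam
  have h : IsOpen {x : Set G.Λ | lam ∈ x} :=
    @IsOpen.preimage _ _ (powersetTopology G.Λ) ⊥ _ hc {p | p} trivial
  exact h.preimage continuous_subtype_val

theorem isOpen_setOf_exists_mem (S : Set G.Λ) :
    IsOpen {x : G.PSpace | ∃ lam ∈ x.1, lam ∈ S} := by
  have : {x : G.PSpace | ∃ lam ∈ x.1, lam ∈ S} = ⋃ lam ∈ S, {x : G.PSpace | lam ∈ x.1} := by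
    ext x
    simp [and_comm]
  rw [this]
  exact isOpen_biUnion fun lam _ => G.isOpen_setOf_mem lam

end PGraph

/-- For any `m ∈ P`, both the domain `D_m` and the range `R_m` of the shift
`T_m` are open subsets of `PS(Λ)`. -/
theorem statement14 {Q : Type} [Group Q] {W : WQLO Q} (G : PGraph Q W)
    (hne : G.FA.Nonempty) (m : Q) (hm : m ∈ W.P) :
    IsOpen {x : G.PSpace | x.1 ∈ G.Dom m} ∧
    IsOpen {y : G.PSpace | y.1 ∈ G.Ran m} := by
  constructor
  · convert G.isOpen_setOf_exists_mem {l | G.d l = m} using 1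
    ext x
    exact ⟨fun h => h.2, fun h => ⟨x.2, h⟩⟩
  · convert G.isOpen_setOf_exists_mem
      {nu | ∃ lam, G.d lam = m ∧ G.s lam = G.r nu ∧ G.mul lam nu ∈ G.FA} using 1
    ext y
    exact PGraph.mem_Ran_iff y.2.1 m
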